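/- arXiv:2502.02554 — 2 statements merged into one kernel-verified Lean document; each statement's English description precedes it below -/
import Mathlib

section
/- Fix an integer L ≥ 2, a real β with 0 < β < 2, and a real a > 0, and set v_n^{(N)} := R^{N−n}(φ ↦ a·L^{−N(2−β)}·cos(√β·φ)) for 1 ≤ n ≤ N. Then there exists a constant C = C(a,L,β) < ∞ such that for all 1 ≤ n ≤ N there is a real constant c with sup_{φ∈ℝ} |v_n^{(N+1)}(φ) − v_n^{(N)}(φ) − c| ≤ C·L^{−(1/2)(2−β)N}. -/
open MeasureTheory ProbabilityTheory Filter

/-- The hierarchical Sine-Gordon RG map: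
`(Rv)(φ) = -L² log ∫ e^{-v(φ+z)} dγ(z)` with `γ` centered Gaussian of variance `2 log L`. -/
noncomputable def SGRG (L : ℕ) (v : ℝ → ℝ) : ℝ → ℝ := fun φ =>
  -(L : ℝ) ^ 2 *
    Real.log (∫ z, Real.exp (-(v (φ + z))) ∂(gaussianReal 0 (2 * Real.log L).toNNReal))

/-- The effective potential `v_n^{(N)} = R^{N-n} v_N^{(N)}` with initial potential
`v_N^{(N)}(φ) = a·L^{-N(2-β)}·cos(√β φ)`. -/
noncomputable def SGv (L : ℕ) (β a : ℝ) (N n : ℕ) : ℝ → ℝ :=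
  (SGRG L)^[N - n] fun φ => a * (L : ℝ) ^ (-(N : ℝ) * (2 - β)) * Real.cos (Real.sqrt β * φ)

namespace SG

/-- Averaging operator. -/
noncomputable def PP (μ : Measure ℝ) (f : ℝ → ℝ) : ℝ → ℝ := fun φ => ∫ z, f (φ + z) ∂μ

/-- Bounded continuous periodic functions. -/
def Nice (T : ℝ) (f : ℝ → ℝ) : Prop :=
  Continuous f ∧ Function.Periodic f T ∧ ∃ B, ∀ x, |f x| ≤ B

lemma integrable_of_bdd {μ : Measure ℝ} [IsProbabilityMeasure μ] {f : ℝ → ℝ} (hf : Continuous f)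
    {B : ℝ} (hB : ∀ x, |f x| ≤ B) : Integrable f μ :=
  Integrable.of_bound hf.aestronglyMeasurable B (Eventually.of_forall hB)

lemma abs_integral_le {μ : Measure ℝ} [IsProbabilityMeasure μ] {f : ℝ → ℝ}
    {B : ℝ} (hB : ∀ x, |f x| ≤ B) : |∫ z, f z ∂μ| ≤ B := by
  have := norm_integral_le_of_norm_le_const (μ := μ) (f := f) (C := B) (Eventually.of_forall hB)
  simpa using this

lemma Nice.integrable {μ : Measure ℝ} [IsProbabilityMeasure μ] {T : ℝ} {f : ℝ → ℝ}
    (hf : Nice T f) (φ : ℝ) : Integrable (fun z => f (φ + z)) μ := by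
  obtain ⟨h1, h2, B, hB⟩ := hf
  exact integrable_of_bdd (by fun_prop) (fun z => hB _)

lemma Nice.P {μ : Measure ℝ} [IsProbabilityMeasure μ] {T : ℝ} {f : ℝ → ℝ}
    (hf : Nice T f) : Nice T (PP μ f) := by
  obtain ⟨h1, h2, B, hB⟩ := hf
  refine ⟨?_, ?_, B, ?_⟩
  · unfold PP
    refine continuous_of_dominated (bound := fun _ => B) ?_ ?_ ?_ ?_
    · intro x; exact (by fun_prop : Continuous fun z => f (x + z)).aestronglyMeasurable
    · intro x; exact Eventually.of_forall fun z => hB _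
    · simp
    · exact Eventually.of_forall fun z => by fun_prop
  · intro x
    simp only [PP]
    congr 1
    ext z
    rw [show x + T + z = (x + z) + T by ring, h2]
  · intro x
    exact abs_integral_le fun z => hB _

lemma Nice.Pk {μ : Measure ℝ} [IsProbabilityMeasure μ] {T : ℝ} {f : ℝ → ℝ}
    (hf : Nice T f) (k : ℕ) : Nice T ((PP μ)^[k] f) := by
  induction k with
  | zero => exact hf
  | succ k ih => rw [Function.iterate_succ_apply']; exact ih.P

lemma Nice.add {T : ℝ} {f g : ℝ → ℝ} (hf : Nice T f) (hg : Nice T g) :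
    Nice T (fun x => f x + g x) := by
  obtain ⟨h1, h2, B, hB⟩ := hf
  obtain ⟨k1, k2, C, hC⟩ := hg
  refine ⟨by fun_prop, fun x => by simp only [h2 x, k2 x], B + C, fun x => ?_⟩
  exact (abs_add_le _ _).trans (add_le_add (hB x) (hC x))

lemma Nice.smul {T : ℝ} {f : ℝ → ℝ} (hf : Nice T f) (c : ℝ) :
    Nice T (fun x => c * f x) := by
  obtain ⟨h1, h2, B, hB⟩ := hf
  refine ⟨by fun_prop, fun x => by simp only [h2 x], |c| * B, fun x => ?_⟩
  rw [abs_mul]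
  exact mul_le_mul_of_nonneg_left (hB x) (abs_nonneg _)

lemma nice_const (T c : ℝ) : Nice T (fun _ => c) :=
  ⟨continuous_const, fun _ => rfl, |c|, fun _ => le_rfl⟩

lemma Nice.sub {T : ℝ} {f g : ℝ → ℝ} (hf : Nice T f) (hg : Nice T g) :
    Nice T (fun x => f x - g x) := by
  have := hf.add (hg.smul (-1))
  convert this using 2
  ring

lemma PP_add {μ : Measure ℝ} [IsProbabilityMeasure μ] {T : ℝ} {f g : ℝ → ℝ}
    (hf : Nice T f) (hg : Nice T g) :
    PP μ (fun x => f x + g x) = fun x => PP μ f x + PP μ g x := by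
  ext x
  exact integral_add (hf.integrable x) (hg.integrable x)

lemma PP_smul {μ : Measure ℝ} {f : ℝ → ℝ} (c : ℝ) :
    PP μ (fun x => c * f x) = fun x => c * PP μ f x := by
  ext x
  exact integral_const_mul _ _

lemma PP_const {μ : Measure ℝ} [IsProbabilityMeasure μ] (c : ℝ) :
    PP μ (fun _ => c) = fun _ => c := by
  ext x
  simp [PP]

lemma Pk_add {μ : Measure ℝ} [IsProbabilityMeasure μ] {T : ℝ} {f g : ℝ → ℝ}
    (hf : Nice T f) (hg : Nice T g) (k : ℕ) :
    (PP μ)^[k] (fun x => f x + g x) = fun x => (PP μ)^[k] f x + (PP μ)^[k] g x := by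
  induction k with
  | zero => rfl
  | succ k ih =>
    simp only [Function.iterate_succ_apply', ih]
    exact PP_add (hf.Pk k) (hg.Pk k)

lemma Pk_smul {μ : Measure ℝ} {f : ℝ → ℝ} (c : ℝ) (k : ℕ) :
    (PP μ)^[k] (fun x => c * f x) = fun x => c * (PP μ)^[k] f x := by
  induction k with
  | zero => rfl
  | succ k ih =>
    simp only [Function.iterate_succ_apply', ih]
    exact PP_smul c

lemma Pk_const {μ : Measure ℝ} [IsProbabilityMeasure μ] (c : ℝ) (k : ℕ) :
    (PP μ)^[k] (fun _ => c) = fun _ => c := by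
  induction k with
  | zero => rfl
  | succ k ih =>
    simp only [Function.iterate_succ_apply', ih]
    exact PP_const c

lemma log_bracket {A y : ℝ} (h1 : Real.exp (-y) ≤ A) (h2 : A ≤ Real.exp y) (hy0 : 0 ≤ y)
    (hy : y ≤ 1) : |1 / A - 1| ≤ 2 * y := by
  have hA : 0 < A := (Real.exp_pos _).trans_le h1
  have e1 := Real.abs_exp_sub_one_le (x := y) (by rwa [abs_of_nonneg hy0])
  have e2 := Real.abs_exp_sub_one_le (x := -y) (by rwa [abs_neg, abs_of_nonneg hy0])
  rw [abs_neg] at e2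
  rw [abs_of_nonneg hy0, abs_le] at e1 e2
  have i1 : 1 / A ≤ Real.exp y := by
    rw [div_le_iff₀ hA]
    calc (1:ℝ) = Real.exp y * Real.exp (-y) := by rw [← Real.exp_add]; simp
      _ ≤ _ := by gcongr
  have i2 : Real.exp (-y) ≤ 1 / A := by
    rw [le_div_iff₀ hA]
    calc Real.exp (-y) * A ≤ Real.exp (-y) * Real.exp y := by gcongr
      _ = 1 := by rw [← Real.exp_add]; simp
  rw [abs_le]
  constructor <;> linarith [e1.1, e1.2, e2.1, e2.2]

lemma log_diff {A B y : ℝ} (h1 : Real.exp (-y) ≤ A) (h2 : A ≤ Real.exp y)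
    (h3 : Real.exp (-y) ≤ B) (h4 : B ≤ Real.exp y) (hy0 : 0 ≤ y) (hy : y ≤ 1) :
    |Real.log A - Real.log B - (A - B)| ≤ 2 * y * |A - B| := by
  have hA : 0 < A := (Real.exp_pos _).trans_le h1
  have hB : 0 < B := (Real.exp_pos _).trans_le h3
  have a1 := log_bracket h1 h2 hy0 hy
  have a2 := log_bracket h3 h4 hy0 hy
  have l1 : Real.log A - Real.log B ≤ (A - B) * (1 / B) := by
    have := Real.log_le_sub_one_of_pos (div_pos hA hB)
    rw [Real.log_div hA.ne' hB.ne'] at this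
    have e : (A - B) * (1 / B) = A / B - 1 := by field_simp
    linarith
  have l2 : (A - B) * (1 / A) ≤ Real.log A - Real.log B := by
    have := Real.log_le_sub_one_of_pos (div_pos hB hA)
    rw [Real.log_div hB.ne' hA.ne'] at this
    have e : (A - B) * (1 / A) = 1 - B / A := by field_simp
    linarith
  have b1 : |(A - B) * (1 / A - 1)| ≤ 2 * y * |A - B| := by
    rw [abs_mul, mul_comm]; gcongr
  have b2 : |(A - B) * (1 / B - 1)| ≤ 2 * y * |A - B| := by
    rw [abs_mul, mul_comm]; gcongr
  rw [abs_le] at *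
  constructor <;> linarith [b1.1, b2.2]

lemma exp_int_bds {μ : Measure ℝ} [IsProbabilityMeasure μ] {w : ℝ → ℝ} {y : ℝ}
    (hw : Continuous w) (hy : ∀ z, |w z| ≤ y) :
    Integrable (fun z => Real.exp (-(w z))) μ ∧
    Real.exp (-y) ≤ ∫ z, Real.exp (-(w z)) ∂μ ∧ ∫ z, Real.exp (-(w z)) ∂μ ≤ Real.exp y := by
  have hi : Integrable (fun z => Real.exp (-(w z))) μ := by
    refine integrable_of_bdd (B := Real.exp y) (by fun_prop) fun z => ?_
    rw [abs_of_pos (Real.exp_pos _)]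
    exact Real.exp_le_exp.2 (by linarith [(abs_le.1 (hy z)).1])
  refine ⟨hi, ?_, ?_⟩
  · have := integral_mono (μ := μ) (integrable_const (Real.exp (-y))) hi
      (fun z => Real.exp_le_exp.2 (by linarith [(abs_le.1 (hy z)).2]))
    simpa using this
  · have := integral_mono (μ := μ) hi (integrable_const (Real.exp y))
      (fun z => Real.exp_le_exp.2 (by linarith [(abs_le.1 (hy z)).1]))
    simpa using this

lemma local_claim {μ : Measure ℝ} [IsProbabilityMeasure μ] {w1 w2 : ℝ → ℝ} {y d : ℝ}
    (c1 : Continuous w1) (c2 : Continuous w2) (h1 : ∀ z, |w1 z| ≤ y) (h2 : ∀ z, |w2 z| ≤ y)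
    (hd : ∀ z, |w1 z - w2 z| ≤ d) (hy : y ≤ 1) (hd1 : d ≤ y) :
    |Real.log (∫ z, Real.exp (-(w1 z)) ∂μ) - Real.log (∫ z, Real.exp (-(w2 z)) ∂μ)
      + ∫ z, (w1 z - w2 z) ∂μ| ≤ 17 * y * d := by
  have hy0 : 0 ≤ y := (abs_nonneg _).trans (h1 0)
  have hd0 : 0 ≤ d := (abs_nonneg _).trans (hd 0)
  obtain ⟨i1, a1, a2⟩ := exp_int_bds (μ := μ) c1 h1
  obtain ⟨i2, b1, b2⟩ := exp_int_bds (μ := μ) c2 h2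
  have i3 : Integrable (fun z => w1 z - w2 z) μ := integrable_of_bdd (by fun_prop) hd
  have hl := log_diff a1 a2 b1 b2 hy0 hy
  set A := ∫ z, Real.exp (-(w1 z)) ∂μ
  set B := ∫ z, Real.exp (-(w2 z)) ∂μ
  have ed : ∀ z, |Real.exp (-(w1 z - w2 z)) - 1| ≤ 2 * d := fun z => by
    have := Real.abs_exp_sub_one_le (x := -(w1 z - w2 z))
      (by rw [abs_neg]; linarith [hd z])
    rw [abs_neg] at this
    linarith [hd z]
  have e2 : ∀ z, |Real.exp (-(w2 z)) - 1| ≤ 2 * y := fun z => by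
    have := Real.abs_exp_sub_one_le (x := -(w2 z)) (by rw [abs_neg]; linarith [h2 z])
    rw [abs_neg] at this
    linarith [h2 z]
  have e3 : ∀ z, |Real.exp (-(w1 z - w2 z)) - 1 + (w1 z - w2 z)| ≤ d * d := fun z => by
    have := Real.abs_exp_sub_one_sub_id_le (x := -(w1 z - w2 z))
      (by rw [abs_neg]; linarith [hd z])
    rw [sub_neg_eq_add, neg_sq, ← sq_abs] at this
    nlinarith [hd z, abs_nonneg (w1 z - w2 z)]
  have key : ∀ z, Real.exp (-(w1 z)) - Real.exp (-(w2 z)) =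
      Real.exp (-(w2 z)) * (Real.exp (-(w1 z - w2 z)) - 1) := fun z => by
    rw [mul_sub, ← Real.exp_add]; ring_nf
  have q1 : |A - B| ≤ 6 * d := by
    have : A - B = ∫ z, (Real.exp (-(w1 z)) - Real.exp (-(w2 z))) ∂μ := (integral_sub i1 i2).symm
    rw [this]
    refine abs_integral_le fun z => ?_
    rw [key, abs_mul]
    have : |Real.exp (-(w2 z))| ≤ 3 := by
      have := (abs_le.1 (e2 z)).2
      rw [abs_of_pos (Real.exp_pos _)]
      linarith
    calc _ ≤ 3 * (2 * d) := mul_le_mul this (ed z) (abs_nonneg _) (by norm_num)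
      _ = _ := by ring
  have q2 : |A - B + ∫ z, (w1 z - w2 z) ∂μ| ≤ 2 * y * (2 * d) + d * d := by
    have : A - B + ∫ z, (w1 z - w2 z) ∂μ =
        ∫ z, (Real.exp (-(w1 z)) - Real.exp (-(w2 z)) + (w1 z - w2 z)) ∂μ := by
      have i4 : Integrable (fun z => Real.exp (-(w1 z)) - Real.exp (-(w2 z))) μ := i1.sub i2
      rw [integral_add i4 i3, integral_sub i1 i2]
    rw [this]
    refine abs_integral_le fun z => ?_
    have : Real.exp (-(w1 z)) - Real.exp (-(w2 z)) + (w1 z - w2 z) =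
      (Real.exp (-(w2 z)) - 1) * (Real.exp (-(w1 z - w2 z)) - 1) +
        (Real.exp (-(w1 z - w2 z)) - 1 + (w1 z - w2 z)) := by rw [key]; ring
    rw [this]
    refine (abs_add_le _ _).trans (add_le_add ?_ (e3 z))
    rw [abs_mul]
    exact mul_le_mul (e2 z) (ed z) (abs_nonneg _) (by linarith)
  calc _ = |(Real.log A - Real.log B - (A - B)) + (A - B + ∫ z, (w1 z - w2 z) ∂μ)| := by
        congr 1; ring
    _ ≤ 2 * y * (6 * d) + (2 * y * (2 * d) + d * d) := by
        refine (abs_add_le _ _).trans (add_le_add (hl.trans ?_) q2)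
        gcongr
    _ ≤ _ := by nlinarith [mul_nonneg hy0 hd0, mul_le_mul_of_nonneg_right hd1 hd0]


/-- Fourier coefficients on a period. -/
noncomputable def coef (s : ℝ) (f : ℝ → ℝ) (q : ℤ) : ℂ :=
  ((s / (2 * Real.pi) : ℝ) : ℂ) *
    ∫ x in (0 : ℝ)..(2 * Real.pi / s), Complex.exp (-(q * s * x * Complex.I)) * (f x : ℂ)

lemma norm_exp_aux (q : ℤ) (s x : ℝ) : ‖Complex.exp (-(q * s * x * Complex.I))‖ = 1 := by
  have := Complex.norm_exp_ofReal_mul_I (-(q * s * x))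
  rw [← this]
  congr 2
  push_cast
  ring

lemma coef_bound {s : ℝ} (hs : 0 < s) {f : ℝ → ℝ} {y : ℝ} (hf : ∀ x, |f x| ≤ y) (q : ℤ) :
    ‖coef s f q‖ ≤ y := by
  have hT : 0 < 2 * Real.pi / s := by positivity
  have := intervalIntegral.norm_integral_le_of_norm_le_const (a := 0) (b := 2 * Real.pi / s)
    (C := y) (f := fun x : ℝ => Complex.exp (-(q * s * x * Complex.I)) * (f x : ℂ)) (by
      intro x _
      rw [norm_mul, norm_exp_aux, one_mul, Complex.norm_real]
      exact hf x)
  unfold coef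
  rw [norm_mul, Complex.norm_real, Real.norm_of_nonneg (by positivity)]
  calc _ ≤ s / (2 * Real.pi) * (y * |2 * Real.pi / s - 0|) := by gcongr
    _ = y := by
      rw [sub_zero, abs_of_pos hT]
      field_simp

lemma coef_PP {μ : Measure ℝ} [IsProbabilityMeasure μ] {s ρ : ℝ} (hs : 0 < s)
    (hchar : ∀ q : ℤ, ∫ z : ℝ, Complex.exp (q * s * z * Complex.I) ∂μ = (ρ : ℂ) ^ (q.natAbs ^ 2))
    {f : ℝ → ℝ} (hf : Nice (2 * Real.pi / s) f) (q : ℤ) :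
    coef s (PP μ f) q = (ρ : ℂ) ^ (q.natAbs ^ 2) * coef s f q := by
  have hT : 0 < 2 * Real.pi / s := by positivity
  obtain ⟨h1, h2, B, hB⟩ := hf
  unfold coef
  rw [mul_left_comm]
  congr 1
  set T := 2 * Real.pi / s with hTdef
  set g : ℝ → ℂ := fun x => Complex.exp (-(q * s * x * Complex.I)) * (f x : ℂ) with hg
  have gper : Function.Periodic g T := by
    intro x
    simp only [hg, h2 x]
    congr 1
    rw [Complex.exp_eq_exp_iff_exists_int]
    refine ⟨-q, ?_⟩
    have : (s : ℂ) ≠ 0 := by exact_mod_cast hs.ne'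
    rw [hTdef]
    push_cast
    field_simp
    ring
  have e1 : ∀ x : ℝ, Complex.exp (-(q * s * x * Complex.I)) * (PP μ f x : ℂ) =
      ∫ z, Complex.exp (q * s * z * Complex.I) * g (x + z) ∂μ := by
    intro x
    unfold PP
    rw [← integral_complex_ofReal, ← integral_const_mul]
    congr 1
    ext z
    simp only [hg]
    rw [← mul_assoc, ← Complex.exp_add]
    congr 2
    push_cast
    ring
  simp_rw [e1]
  rw [intervalIntegral_integral_swap]
  · have e2 : ∀ z : ℝ, ∫ x in (0 : ℝ)..T, Complex.exp (q * s * z * Complex.I) * g (x + z) =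
        Complex.exp (q * s * z * Complex.I) * ∫ x in (0 : ℝ)..T, g x := by
      intro z
      rw [intervalIntegral.integral_const_mul, intervalIntegral.integral_comp_add_right]
      congr 1
      have := gper.intervalIntegral_add_eq z 0
      rw [zero_add] at this
      rw [← this, zero_add, add_comm]
    simp_rw [e2]
    rw [integral_mul_const, hchar]
  · have : IsFiniteMeasure (volume.restrict (Set.uIoc 0 T)) := ⟨by simp [Set.uIoc]⟩
    refine Integrable.of_bound (C := B) ?_ ?_
    · apply Continuous.aestronglyMeasurable
      simp only [hg, Function.uncurry_def]
      fun_prop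
    · refine Eventually.of_forall fun p => ?_
      simp only [hg, Function.uncurry_def]
      have a1 := norm_exp_aux (-q) s p.2
      have a2 := norm_exp_aux q s (p.1 + p.2)
      rw [norm_mul, norm_mul, a2, one_mul, Complex.norm_real]
      have : ‖Complex.exp (q * s * p.2 * Complex.I)‖ = 1 := by
        rw [← a1]; congr 2; push_cast; ring
      rw [this, one_mul]
      exact hB _

lemma coef_Pk {μ : Measure ℝ} [IsProbabilityMeasure μ] {s ρ : ℝ} (hs : 0 < s)
    (hchar : ∀ q : ℤ, ∫ z : ℝ, Complex.exp (q * s * z * Complex.I) ∂μ = (ρ : ℂ) ^ (q.natAbs ^ 2))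
    {f : ℝ → ℝ} (hf : Nice (2 * Real.pi / s) f) (q : ℤ) (k : ℕ) :
    coef s ((PP μ)^[k] f) q = (ρ : ℂ) ^ (k * q.natAbs ^ 2) * coef s f q := by
  induction k with
  | zero => simp
  | succ k ih =>
    rw [Function.iterate_succ_apply', coef_PP hs hchar (hf.Pk k), ih]
    ring

lemma summable_natAbs {ρ : ℝ} (h0 : 0 < ρ) (h1 : ρ < 1) : Summable fun q : ℤ => ρ ^ q.natAbs := by
  apply Summable.of_nat_of_neg
  · simpa using summable_geometric_of_lt_one h0.le h1
  · simpa using summable_geometric_of_lt_one h0.le h1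

lemma inversion {s : ℝ} (hs : 0 < s) {f : ℝ → ℝ} (hf : Nice (2 * Real.pi / s) f)
    (hsum : Summable (coef s f)) (x : ℝ) :
    HasSum (fun q : ℤ => coef s f q * Complex.exp (q * s * x * Complex.I)) (f x : ℂ) := by
  have hT : 0 < 2 * Real.pi / s := by positivity
  have hsc : (s : ℂ) ≠ 0 := by exact_mod_cast hs.ne'
  have hpi : (Real.pi : ℂ) ≠ 0 := by exact_mod_cast Real.pi_ne_zero
  obtain ⟨h1, h2, B, hB⟩ := hf
  set T := 2 * Real.pi / s with hTdef
  have : Fact (0 < T) := ⟨hT⟩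
  have hper : Function.Periodic (fun x => (f x : ℂ)) T := fun x => by simp only [h2 x]
  let F : C(AddCircle T, ℂ) := ⟨hper.lift, by
    refine continuous_coinduced_dom.2 ?_
    change Continuous fun x => (f x : ℂ)
    fun_prop⟩
  have hF : ∀ x : ℝ, F (x : AddCircle T) = (f x : ℂ) := fun x => hper.lift_coe x
  have hc : fourierCoeff F = coef s f := by
    ext q
    rw [fourierCoeff_eq_intervalIntegral F q 0, zero_add]
    unfold coef
    rw [Complex.real_smul]
    congr 1
    · rw [hTdef]; simp
    · congr 1
      ext x
      rw [fourier_coe_apply, hF, smul_eq_mul]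
      congr 2
      rw [hTdef]
      push_cast
      field_simp
  have := has_pointwise_sum_fourier_series_of_summable (f := F) (by rw [hc]; exact hsum)
    (x : AddCircle T)
  rw [hF, hc] at this
  convert! this using 2 with q
  rw [fourier_coe_apply, smul_eq_mul]
  congr 2
  rw [hTdef]
  push_cast
  field_simp

/-- Adapted norm bound. -/
def Abd (μ : Measure ℝ) (ρ : ℝ) (f : ℝ → ℝ) (x : ℝ) : Prop :=
  ∃ m : ℝ, ∀ (k : ℕ) (φ : ℝ), |(PP μ)^[k] f φ - m| ≤ ρ ^ k * x

lemma abd_of_bdd0 {μ : Measure ℝ} [IsProbabilityMeasure μ] {s ρ : ℝ} (hs : 0 < s)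
    (h0 : 0 < ρ) (h1 : ρ < 1)
    (hchar : ∀ q : ℤ, ∫ z : ℝ, Complex.exp (q * s * z * Complex.I) ∂μ = (ρ : ℂ) ^ (q.natAbs ^ 2))
    {f : ℝ → ℝ} (hf : Nice (2 * Real.pi / s) f) {y : ℝ} (hy : ∀ x, |f x| ≤ y) :
    Abd μ ρ f ((2 + ρ⁻¹ * ∑' q : ℤ, ρ ^ q.natAbs) * y) := by
  have hy0 : 0 ≤ y := (abs_nonneg _).trans (hy 0)
  have hS := summable_natAbs h0 h1
  have hS0 : 0 ≤ ∑' q : ℤ, ρ ^ q.natAbs := tsum_nonneg fun q => by positivity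
  refine ⟨(coef s f 0).re, fun k φ => ?_⟩
  have hm : |(coef s f 0).re| ≤ y := (Complex.abs_re_le_norm _).trans (coef_bound hs hy 0)
  rcases Nat.eq_zero_or_pos k with rfl | hk
  · simp only [Function.iterate_zero, id, pow_zero, one_mul]
    have : 0 ≤ ρ⁻¹ * ∑' q : ℤ, ρ ^ q.natAbs := by positivity
    calc _ ≤ |f φ| + |(coef s f 0).re| := abs_sub _ _
      _ ≤ 2 * y := by linarith [hy φ]
      _ ≤ _ := by nlinarith
  have hb : ∀ q : ℤ, q ≠ 0 → ‖coef s ((PP μ)^[k] f) q‖ ≤ ρ ^ k * ρ⁻¹ * y * ρ ^ q.natAbs := by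
    intro q hq
    rw [coef_Pk hs hchar hf, norm_mul, norm_pow, Complex.norm_real, Real.norm_of_nonneg h0.le]
    have hq1 : 1 ≤ q.natAbs := Int.natAbs_pos.2 hq
    have e : k + q.natAbs ≤ k * q.natAbs ^ 2 + 1 := by
      obtain ⟨a, ha⟩ := Nat.exists_eq_add_of_le hq1
      obtain ⟨b, hb⟩ := Nat.exists_eq_add_of_le hk
      rw [ha, hb]
      nlinarith [Nat.zero_le (a*b), Nat.zero_le (a*a*b), Nat.zero_le (a*a)]
    have e' : ρ ^ (k * q.natAbs ^ 2) ≤ ρ ^ k * ρ⁻¹ * ρ ^ q.natAbs := by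
      have := pow_le_pow_of_le_one h0.le h1.le e
      rw [pow_add, pow_add, pow_one] at this
      rw [show ρ ^ k * ρ⁻¹ * ρ ^ q.natAbs = (ρ ^ k * ρ ^ q.natAbs) / ρ by ring, le_div_iff₀ h0]
      exact this
    calc _ ≤ (ρ ^ k * ρ⁻¹ * ρ ^ q.natAbs) * y :=
          mul_le_mul e' (coef_bound hs hy q) (norm_nonneg _) (by positivity)
      _ = _ := by ring
  have hsb : Summable fun q : ℤ => ρ ^ k * ρ⁻¹ * y * ρ ^ q.natAbs := hS.mul_left _
  have hsum : Summable (coef s ((PP μ)^[k] f)) := by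
    refine Summable.of_norm_bounded_eventually hsb ?_
    rw [Filter.eventually_cofinite]
    refine (Set.finite_singleton (0 : ℤ)).subset fun q hq => ?_
    by_contra h
    exact hq (hb q h)
  have hinv := inversion hs (hf.Pk (μ := μ) k) hsum φ
  have hc0 : coef s ((PP μ)^[k] f) 0 = coef s f 0 := by
    rw [coef_Pk hs hchar hf]; simp
  have hd := hasSum_ite_sub_hasSum hinv 0
  simp only [hc0] at hd
  have hn := tsum_of_norm_bounded (f := fun n : ℤ => if n = 0 then (0 : ℂ) else
      coef s ((PP μ)^[k] f) n * Complex.exp (n * s * φ * Complex.I)) hsb.hasSum (by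
    intro q
    by_cases hq : q = 0
    · simp only [hq, if_true, norm_zero]; positivity
    · simp only [hq, if_false]
      rw [norm_mul]
      have a1 := norm_exp_aux (-q) s φ
      have : ‖Complex.exp (q * s * φ * Complex.I)‖ = 1 := by
        rw [← a1]; congr 2; push_cast; ring
      rw [this, mul_one]
      exact hb q hq)
  rw [hd.tsum_eq, tsum_mul_left] at hn
  have hr := (Complex.abs_re_le_norm _).trans hn
  simp at hr
  refine hr.trans ?_
  have : 0 ≤ ρ ^ k * y := by positivity
  nlinarith

lemma abd_of_bdd {μ : Measure ℝ} [IsProbabilityMeasure μ] {s ρ : ℝ} (hs : 0 < s)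
    (h0 : 0 < ρ) (h1 : ρ < 1)
    (hchar : ∀ q : ℤ, ∫ z : ℝ, Complex.exp (q * s * z * Complex.I) ∂μ = (ρ : ℂ) ^ (q.natAbs ^ 2)) :
    ∃ K : ℝ, 0 < K ∧ ∀ (f : ℝ → ℝ), Nice (2 * Real.pi / s) f → ∀ c y : ℝ,
      (∀ x, |f x - c| ≤ y) → Abd μ ρ f (K * y) := by
  refine ⟨2 + ρ⁻¹ * ∑' q : ℤ, ρ ^ q.natAbs, ?_, ?_⟩
  · have : 0 ≤ ∑' q : ℤ, ρ ^ q.natAbs := tsum_nonneg fun q => by positivity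
    positivity
  intro f hf c y hy
  have hg : Nice (2 * Real.pi / s) (fun x => f x + (-c)) := hf.add (nice_const _ _)
  obtain ⟨m, hm⟩ := abd_of_bdd0 hs h0 h1 hchar hg hy
  refine ⟨m + c, fun k φ => ?_⟩
  have := hm k φ
  rw [Pk_add hf (nice_const _ _), Pk_const] at this
  convert this using 2
  ring

/-- The Gaussian measure of the RG map. -/
noncomputable abbrev gm (L : ℕ) : Measure ℝ := gaussianReal 0 (2 * Real.log L).toNNReal

lemma hchar_gm {L : ℕ} (hL : 2 ≤ L) {β : ℝ} (hβ : 0 < β) (q : ℤ) :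
    ∫ z : ℝ, Complex.exp (q * (Real.sqrt β : ℝ) * z * Complex.I) ∂(gm L) =
      (((L : ℝ) ^ (-β) : ℝ) : ℂ) ^ (q.natAbs ^ 2) := by
  have hL0 : (0 : ℝ) < L := by positivity
  have h := charFun_gaussianReal (μ := 0) (v := (2 * Real.log L).toNNReal) (q * Real.sqrt β)
  rw [charFun_apply_real] at h
  have hlog : 0 ≤ 2 * Real.log L := by
    have := Real.log_nonneg (x := L) (by exact_mod_cast (by omega : 1 ≤ L))
    linarith
  calc _ = ∫ x : ℝ, Complex.exp (((q * Real.sqrt β : ℝ) : ℂ) * x * Complex.I) ∂(gm L) := by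
        push_cast; rfl
    _ = _ := by
      rw [h]
      rw [Real.rpow_def_of_pos hL0, Complex.ofReal_exp, ← Complex.exp_nat_mul]
      congr 1
      have e1 : (((2 * Real.log L).toNNReal : ℝ) : ℂ) = ((2 * Real.log L : ℝ) : ℂ) := by
        rw [Real.coe_toNNReal _ hlog]
      have e2 : ((q.natAbs ^ 2 : ℕ) : ℂ) = (q : ℂ) ^ 2 := by
        have h := congrArg (Int.cast : ℤ → ℂ) (Int.natAbs_sq q)
        rw [Int.cast_pow, Int.cast_pow, Int.cast_natCast] at h
        rw [Nat.cast_pow]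
        exact h
      rw [e1, e2]
      have e3 : ((Real.sqrt β : ℝ) : ℂ) ^ 2 = (β : ℂ) := by
        rw [← Complex.ofReal_pow, Real.sq_sqrt hβ.le]
      push_cast
      rw [mul_pow, e3]
      ring

lemma PP_cos {L : ℕ} (hL : 2 ≤ L) {β : ℝ} (hβ : 0 < β) (φ : ℝ) :
    PP (gm L) (fun x => Real.cos (Real.sqrt β * x)) φ =
      (L : ℝ) ^ (-β) * Real.cos (Real.sqrt β * φ) := by
  have h := hchar_gm hL hβ 1
  set s := Real.sqrt β
  set ρ := (L : ℝ) ^ (-β)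
  have h2 : ∫ z : ℝ, Complex.exp ((s * φ : ℝ) * Complex.I) *
      Complex.exp ((1 : ℤ) * (s : ℝ) * z * Complex.I) ∂(gm L) =
      Complex.exp ((s * φ : ℝ) * Complex.I) * ρ := by
    rw [integral_const_mul, h]; simp
  have h3 := congrArg Complex.re h2
  rw [← RCLike.re_eq_complex_re, ← integral_re] at h3
  · unfold PP
    have e : ∀ z : ℝ, RCLike.re (Complex.exp ((s * φ : ℝ) * Complex.I) *
      Complex.exp ((1 : ℤ) * (s : ℝ) * z * Complex.I)) = Real.cos (s * (φ + z)) := by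
      intro z
      rw [← Complex.exp_add, show ((s * φ : ℝ) : ℂ) * Complex.I + (1 : ℤ) * (s : ℝ) * z * Complex.I
        = ((s * (φ + z) : ℝ) : ℂ) * Complex.I by push_cast; ring]
      exact Complex.exp_ofReal_mul_I_re _
    simp_rw [e] at h3
    rw [h3, RCLike.re_eq_complex_re, Complex.re_mul_ofReal, Complex.exp_ofReal_mul_I_re]
    ring
  · refine Integrable.of_bound (C := 1) (Continuous.aestronglyMeasurable (by fun_prop)) ?_
    refine Eventually.of_forall fun z => ?_
    rw [norm_mul, Complex.norm_exp_ofReal_mul_I, one_mul,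
      show ((1 : ℤ) : ℂ) * (s : ℝ) * z * Complex.I = ((s * z : ℝ) : ℂ) * Complex.I by
        push_cast; ring, Complex.norm_exp_ofReal_mul_I]

lemma nice_cos {β : ℝ} (hβ : 0 < β) (α : ℝ) :
    Nice (2 * Real.pi / Real.sqrt β) (fun x => α * Real.cos (Real.sqrt β * x)) := by
  have hs : 0 < Real.sqrt β := Real.sqrt_pos.2 hβ
  refine Nice.smul ⟨by fun_prop, fun x => ?_, 1, fun x => Real.abs_cos_le_one _⟩ α
  rw [show Real.sqrt β * (x + 2 * Real.pi / Real.sqrt β) = Real.sqrt β * x + 2 * Real.pi by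
    field_simp]
  exact Real.cos_add_two_pi _

lemma R_shift (L : ℕ) {v : ℝ → ℝ} {T : ℝ} (hv : Nice T v) (m φ : ℝ) :
    SGRG L v φ = (L : ℝ) ^ 2 * m -
      (L : ℝ) ^ 2 * Real.log (∫ z, Real.exp (-(v (φ + z) - m)) ∂(gm L)) := by
  obtain ⟨h1, h2, B, hB⟩ := hv
  have hw : Continuous fun z => v (φ + z) - m := by fun_prop
  obtain ⟨i, a1, a2⟩ := exp_int_bds (μ := gm L) hw (y := B + |m|)
    (fun z => (abs_sub _ _).trans (by linarith [hB (φ + z)]))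
  have hpos := (Real.exp_pos _).trans_le a1
  unfold SGRG
  have : ∫ z, Real.exp (-(v (φ + z))) ∂(gm L) =
      Real.exp (-m) * ∫ z, Real.exp (-(v (φ + z) - m)) ∂(gm L) := by
    rw [← integral_const_mul]
    congr 1
    ext z
    rw [← Real.exp_add]
    ring_nf
  rw [this, Real.log_mul (Real.exp_pos _).ne' hpos.ne', Real.log_exp]
  ring

lemma R_bdd (L : ℕ) {v : ℝ → ℝ} (hv : Continuous v) {y : ℝ} (hy : ∀ x, |v x| ≤ y) (φ : ℝ) :
    |SGRG L v φ| ≤ (L : ℝ) ^ 2 * y := by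
  have hw : Continuous fun z => v (φ + z) := by fun_prop
  obtain ⟨i, a1, a2⟩ := exp_int_bds (μ := gm L) hw (fun z => hy _)
  have hpos := (Real.exp_pos _).trans_le a1
  unfold SGRG
  rw [abs_mul, abs_neg, abs_of_nonneg (by positivity : (0 : ℝ) ≤ (L : ℝ) ^ 2)]
  gcongr
  rw [abs_le]
  exact ⟨(Real.le_log_iff_exp_le hpos).2 a1, (Real.log_le_iff_le_exp hpos).2 a2⟩

lemma Nice.R {L : ℕ} {T : ℝ} {v : ℝ → ℝ} (hv : Nice T v) : Nice T (SGRG L v) := by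
  obtain ⟨h1, h2, B, hB⟩ := hv
  have hexp : Nice T (fun x => Real.exp (-(v x))) := by
    refine ⟨by fun_prop, fun x => by simp only [h2 x], Real.exp B, fun x => ?_⟩
    rw [abs_of_pos (Real.exp_pos _)]
    exact Real.exp_le_exp.2 (by linarith [(abs_le.1 (hB x)).1])
  have hP := hexp.P (μ := gm L)
  refine ⟨?_, fun x => ?_, (L : ℝ) ^ 2 * B, R_bdd L h1 hB⟩
  · change Continuous fun φ => -(L : ℝ) ^ 2 * Real.log (PP (gm L) (fun x => Real.exp (-(v x))) φ)
    refine continuous_const.mul (hP.1.log fun φ => ?_)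
    have hw : Continuous fun z => v (φ + z) := by fun_prop
    obtain ⟨i, a1, a2⟩ := exp_int_bds (μ := gm L) hw (fun z => hB _)
    exact ((Real.exp_pos _).trans_le a1).ne'
  · have := hP.2.1 x
    change -(L : ℝ) ^ 2 * Real.log (PP (gm L) (fun x => Real.exp (-(v x))) (x + T)) = _
    rw [this]; rfl

lemma R_lip (L : ℕ) {T : ℝ} {v1 v2 : ℝ → ℝ} (h1 : Nice T v1) (h2 : Nice T v2) {c y : ℝ}
    (h : ∀ φ, |v1 φ - v2 φ - c| ≤ y) (φ : ℝ) :
    |SGRG L v1 φ - SGRG L v2 φ - (L : ℝ) ^ 2 * c| ≤ (L : ℝ) ^ 2 * y := by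
  rw [R_shift L h1 c, R_shift L h2 0]
  simp only [sub_zero]
  obtain ⟨c1, -, B1, hB1⟩ := h1
  obtain ⟨c2, -, B2, hB2⟩ := h2
  obtain ⟨i, a1, a2⟩ := exp_int_bds (μ := gm L) (w := fun z => v1 (φ + z) - c) (by fun_prop)
    (y := B1 + |c|) (fun z => (abs_sub _ _).trans (by linarith [hB1 (φ + z)]))
  obtain ⟨j, b1, b2⟩ := exp_int_bds (μ := gm L) (w := fun z => v2 (φ + z)) (by fun_prop)
    (fun z => hB2 _)
  have hA := (Real.exp_pos _).trans_le a1
  have hB := (Real.exp_pos _).trans_le b1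
  have k1 := integral_mono (μ := gm L) i (j.const_mul (Real.exp y)) (fun z => by
    simp only [← Real.exp_add]
    exact Real.exp_le_exp.2 (by linarith [(abs_le.1 (h (φ + z))).1]))
  have k2 := integral_mono (μ := gm L) j (i.const_mul (Real.exp y)) (fun z => by
    simp only [← Real.exp_add]
    exact Real.exp_le_exp.2 (by linarith [(abs_le.1 (h (φ + z))).2]))
  simp only [integral_const_mul] at k1 k2
  have l1 := Real.log_le_log hA k1
  have l2 := Real.log_le_log hB k2
  rw [Real.log_mul (Real.exp_pos _).ne' (by positivity), Real.log_exp] at l1 l2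
  generalize Real.log (∫ z, Real.exp (-(v1 (φ + z) - c)) ∂(gm L)) = A at *
  generalize Real.log (∫ z, Real.exp (-(v2 (φ + z))) ∂(gm L)) = B at *
  have : (L : ℝ) ^ 2 * c - (L : ℝ) ^ 2 * A - ((L : ℝ) ^ 2 * 0 - (L : ℝ) ^ 2 * B) - (L : ℝ) ^ 2 * c
    = (L : ℝ) ^ 2 * (B - A) := by ring
  rw [this, abs_mul, abs_of_nonneg (by positivity : (0 : ℝ) ≤ (L : ℝ) ^ 2)]
  gcongr
  rw [abs_le]
  constructor <;> linarith

lemma R_lin (L : ℕ) {T : ℝ} {v1 v2 : ℝ → ℝ} (h1 : Nice T v1) (h2 : Nice T v2) {m1 md x d : ℝ}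
    (hx : ∀ φ, |v1 φ - m1| ≤ x) (hd : ∀ φ, |v1 φ - v2 φ - md| ≤ d) (hxd : x + d ≤ 1) (φ : ℝ) :
    |SGRG L v1 φ - SGRG L v2 φ - (L : ℝ) ^ 2 * PP (gm L) (fun φ => v1 φ - v2 φ) φ| ≤
      (L : ℝ) ^ 2 * (17 * (x + d) * d) := by
  rw [R_shift L h1 m1, R_shift L h2 (m1 - md)]
  have hx0 : 0 ≤ x := (abs_nonneg _).trans (hx 0)
  have hd0 : 0 ≤ d := (abs_nonneg _).trans (hd 0)
  have ha := h1.1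
  have hb := h2.1
  have hdif : ∀ z, v1 (φ + z) - m1 - (v2 (φ + z) - (m1 - md)) = v1 (φ + z) - v2 (φ + z) - md :=
    fun z => by ring
  have lc := local_claim (μ := gm L) (w1 := fun z => v1 (φ + z) - m1)
    (w2 := fun z => v2 (φ + z) - (m1 - md)) (y := x + d) (d := d) (by fun_prop) (by fun_prop)
    (fun z => by linarith [hx (φ + z)])
    (fun z => by
      have := abs_sub (v1 (φ + z) - m1) (v1 (φ + z) - v2 (φ + z) - md)
      rw [show v1 (φ + z) - m1 - (v1 (φ + z) - v2 (φ + z) - md) = v2 (φ + z) - (m1 - md) by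
        ring] at this
      linarith [hx (φ + z), hd (φ + z)])
    (fun z => by rw [hdif]; exact hd _) hxd (by linarith)
  simp only [hdif] at lc
  have e : ∫ z, (v1 (φ + z) - v2 (φ + z) - md) ∂(gm L) =
      PP (gm L) (fun φ => v1 φ - v2 φ) φ - md := by
    rw [integral_sub ((h1.sub h2).integrable φ) (integrable_const _)]
    simp [PP]
  rw [e] at lc
  generalize Real.log (∫ z, Real.exp (-(v1 (φ + z) - m1)) ∂(gm L)) = A at *
  generalize Real.log (∫ z, Real.exp (-(v2 (φ + z) - (m1 - md))) ∂(gm L)) = B at *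
  generalize PP (gm L) (fun φ => v1 φ - v2 φ) φ = p at *
  rw [show (L : ℝ) ^ 2 * m1 - (L : ℝ) ^ 2 * A - ((L : ℝ) ^ 2 * (m1 - md) - (L : ℝ) ^ 2 * B) -
    (L : ℝ) ^ 2 * p = -((L : ℝ) ^ 2 * (A - B + (p - md))) by ring, abs_neg, abs_mul,
    abs_of_nonneg (by positivity : (0 : ℝ) ≤ (L : ℝ) ^ 2)]
  gcongr

lemma Abd.add {μ : Measure ℝ} [IsProbabilityMeasure μ] {ρ T : ℝ} {f g : ℝ → ℝ} {x y : ℝ}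
    (hf : Nice T f) (hg : Nice T g) (h1 : Abd μ ρ f x) (h2 : Abd μ ρ g y) :
    Abd μ ρ (fun φ => f φ + g φ) (x + y) := by
  obtain ⟨m, hm⟩ := h1
  obtain ⟨n, hn⟩ := h2
  refine ⟨m + n, fun k φ => ?_⟩
  rw [Pk_add hf hg]
  have := abs_add_le ((PP μ)^[k] f φ - m) ((PP μ)^[k] g φ - n)
  rw [show (PP μ)^[k] f φ + (PP μ)^[k] g φ - (m + n) =
    ((PP μ)^[k] f φ - m) + ((PP μ)^[k] g φ - n) by ring, mul_add]
  linarith [hm k φ, hn k φ]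

lemma Abd.smulP {μ : Measure ℝ} {ρ : ℝ} {f : ℝ → ℝ} {x c : ℝ}
    (hc : 0 ≤ c) (h1 : Abd μ ρ f x) :
    Abd μ ρ (fun φ => c * PP μ f φ) (c * ρ * x) := by
  obtain ⟨m, hm⟩ := h1
  refine ⟨c * m, fun k φ => ?_⟩
  rw [Pk_smul, ← Function.iterate_succ_apply, ← mul_sub, abs_mul, abs_of_nonneg hc]
  calc _ ≤ c * (ρ ^ (k + 1) * x) := by gcongr; exact hm _ _
    _ = _ := by ring

lemma Abd.mono {μ : Measure ℝ} {ρ : ℝ} (hρ : 0 ≤ ρ) {f : ℝ → ℝ} {x y : ℝ}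
    (hxy : x ≤ y) (h1 : Abd μ ρ f x) : Abd μ ρ f y := by
  obtain ⟨m, hm⟩ := h1
  exact ⟨m, fun k φ => (hm k φ).trans (by gcongr)⟩

lemma step {L : ℕ} {T ρ K : ℝ}
    (hK : ∀ (f : ℝ → ℝ), Nice T f → ∀ c y : ℝ, (∀ x, |f x - c| ≤ y) → Abd (gm L) ρ f (K * y))
    {v1 v2 : ℝ → ℝ} (h1 : Nice T v1) (h2 : Nice T v2) {x d : ℝ}
    (hx : Abd (gm L) ρ v1 x) (hd : Abd (gm L) ρ (fun φ => v1 φ - v2 φ) d) (hxd : x + d ≤ 1) :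
    Abd (gm L) ρ (fun φ => SGRG L v1 φ - SGRG L v2 φ)
      ((L : ℝ) ^ 2 * ρ * d + K * ((L : ℝ) ^ 2 * (17 * (x + d) * d))) := by
  obtain ⟨m1, hm1⟩ := id hx
  obtain ⟨md, hmd⟩ := id hd
  have hq := R_lin L h1 h2 (m1 := m1) (md := md) (x := x) (d := d)
    (fun φ => by simpa using hm1 0 φ) (fun φ => by simpa using hmd 0 φ) hxd
  have n1 : Nice T (fun φ => (L : ℝ) ^ 2 * PP (gm L) (fun φ => v1 φ - v2 φ) φ) :=
    ((h1.sub h2).P).smul _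
  have n2 := ((h1.R (L := L)).sub (h2.R (L := L))).sub n1
  have := Abd.add n1 n2 (hd.smulP (by positivity)) (hK _ n2 0 _ (by simpa using hq))
  convert this using 2
  ring

lemma SGv_succ (L : ℕ) (β a : ℝ) (N n : ℕ) (h : n < N) :
    SGv L β a N n = SGRG L (SGv L β a N (n + 1)) := by
  unfold SGv
  rw [show N - n = (N - (n + 1)) + 1 by omega, Function.iterate_succ_apply']

lemma SGv_self (L : ℕ) (hL : 2 ≤ L) (β a : ℝ) (N : ℕ) :
    SGv L β a N N = fun φ => (a * ((L : ℝ) ^ (-(2 - β) / 2)) ^ (2 * N)) *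
      Real.cos (Real.sqrt β * φ) := by
  unfold SGv
  rw [Nat.sub_self, Function.iterate_zero, id]
  ext φ
  rw [← Real.rpow_natCast, ← Real.rpow_mul (by positivity)]
  congr 3
  push_cast
  ring

lemma SGv_nice (L : ℕ) {β : ℝ} (hβ : 0 < β) (a : ℝ) (N n : ℕ) :
    Nice (2 * Real.pi / Real.sqrt β) (SGv L β a N n) := by
  unfold SGv
  generalize N - n = k
  induction k with
  | zero => exact nice_cos hβ _
  | succ k ih => rw [Function.iterate_succ_apply']; exact ih.R

lemma R_zero (L : ℕ) (φ : ℝ) : SGRG L (fun _ => 0) φ = 0 := by simp [SGRG]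

lemma descent (L : ℕ) {β : ℝ} (hβ : 0 < β) (a y : ℝ) (N : ℕ) (i : ℕ) : ∀ n, n + i ≤ N →
    (∃ c, ∀ φ, |SGv L β a (N + 1) (n + i) φ - SGv L β a N (n + i) φ - c| ≤ y) →
    ∃ c, ∀ φ, |SGv L β a (N + 1) n φ - SGv L β a N n φ - c| ≤ ((L : ℝ) ^ 2) ^ i * y := by
  induction i with
  | zero => intro n _ h; simpa using h
  | succ i ih =>
    intro n hn h
    rw [show n + (i + 1) = (n + 1) + i by ring] at h hn
    obtain ⟨c, hc⟩ := ih (n + 1) hn h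
    refine ⟨(L : ℝ) ^ 2 * c, fun φ => ?_⟩
    rw [SGv_succ L β a (N + 1) n (by omega), SGv_succ L β a N n (by omega)]
    refine (R_lip L (SGv_nice L hβ _ _ _) (SGv_nice L hβ _ _ _) hc φ).trans (le_of_eq ?_)
    ring

lemma size_step {r D Y c u P : ℝ} (hD : 0 < D) (hY : 0 < Y) (hr0 : 0 < r) (hr1 : r < 1)
    (hc : c * (1 - r ^ 2) = 8 * D * Y) (hc0 : 0 < c) (hu : 0 < u) (hcu : c * u ≤ 1)
    (hP : P * r ^ 2 = 1) :
    P * (Y * (1 + c * (r ^ 2 * u)) * (r ^ 2 * u)) +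
      2 * D * (Y * (1 + c * (r ^ 2 * u)) * (r ^ 2 * u)) ^ 2 ≤ Y * (1 + c * u) * u := by
  have hr2 : r ^ 2 ≤ 1 := pow_le_one₀ hr0.le hr1.le
  have e1 : P * (Y * (1 + c * (r ^ 2 * u)) * (r ^ 2 * u)) = Y * (1 + c * (r ^ 2 * u)) * u := by
    linear_combination (Y * (1 + c * (r ^ 2 * u)) * u) * hP
  have h0 : r ^ 2 * u ≤ u := by nlinarith
  have h1 : Y * (1 + c * (r ^ 2 * u)) * (r ^ 2 * u) ≤ Y * (1 + 1) * u := by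
    have : c * (r ^ 2 * u) ≤ 1 := (mul_le_mul_of_nonneg_left h0 hc0.le).trans hcu
    gcongr
  have h2 : (Y * (1 + c * (r ^ 2 * u)) * (r ^ 2 * u)) ^ 2 ≤ (Y * (1 + 1) * u) ^ 2 := by
    gcongr
  have h3 : 2 * D * (Y * (1 + c * (r ^ 2 * u)) * (r ^ 2 * u)) ^ 2 ≤
    2 * D * (Y * (1 + 1) * u) ^ 2 := by gcongr
  have e2 : Y * (1 + c * u) * u - Y * (1 + c * (r ^ 2 * u)) * u = 2 * D * (Y * (1 + 1) * u) ^ 2 := by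
    linear_combination Y * u ^ 2 * hc
  rw [e1]
  linarith

lemma main_large (L : ℕ) (hL : 2 ≤ L) {β a : ℝ} (hβ0 : 0 < β) (hβ2 : β < 2) (ha : 0 < a) :
    ∃ (n0 : ℕ) (C : ℝ), 0 < C ∧ ∀ N n : ℕ, n0 ≤ n → n ≤ N →
      ∃ c : ℝ, ∀ φ : ℝ, |SGv L β a (N + 1) n φ - SGv L β a N n φ - c| ≤
        C * ((L : ℝ) ^ (-(2 - β) / 2)) ^ N := by
  have hs : 0 < Real.sqrt β := Real.sqrt_pos.2 hβ0
  have hL1 : (1 : ℝ) < L := by exact_mod_cast (by omega : 1 < L)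
  have hL0 : (0 : ℝ) < L := by linarith
  have hself := SGv_self L hL β a
  have hnice := SGv_nice L hβ0 a
  have hρ0 : 0 < (L : ℝ) ^ (-β) := Real.rpow_pos_of_pos hL0 _
  have hρ1 : (L : ℝ) ^ (-β) < 1 := Real.rpow_lt_one_of_one_lt_of_neg hL1 (by linarith)
  have hr0 : 0 < (L : ℝ) ^ (-(2 - β) / 2) := Real.rpow_pos_of_pos hL0 _
  have hr1 : (L : ℝ) ^ (-(2 - β) / 2) < 1 := Real.rpow_lt_one_of_one_lt_of_neg hL1 (by linarith)
  have hP : ((L : ℝ) ^ 2 * (L : ℝ) ^ (-β)) * ((L : ℝ) ^ (-(2 - β) / 2)) ^ 2 = 1 := by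
    rw [← Real.rpow_natCast, ← Real.rpow_natCast, ← Real.rpow_mul hL0.le, ← Real.rpow_add hL0,
      ← Real.rpow_add hL0]
    rw [← Real.rpow_zero (L : ℝ)]
    congr 1
    push_cast
    ring
  have hcos := PP_cos hL hβ0
  obtain ⟨K, hK0, hK⟩ := abd_of_bdd (μ := gm L) hs hρ0 hρ1 (hchar_gm hL hβ0)
  generalize (L : ℝ) ^ (-(2 - β) / 2) = r at *
  generalize (L : ℝ) ^ (-β) = ρ at *
  generalize 2 * Real.pi / Real.sqrt β = T at *
  set D : ℝ := 17 * (L : ℝ) ^ 2 * K with hDdef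
  have hD : 0 < D := by positivity
  set Y : ℝ := K * a with hYdef
  have hY : 0 < Y := by positivity
  have hr2 : r ^ 2 < 1 := pow_lt_one₀ hr0.le hr1 (by norm_num)
  obtain ⟨c, hc⟩ : ∃ c : ℝ, c * (1 - r ^ 2) = 8 * D * Y :=
    ⟨8 * D * Y / (1 - r ^ 2), div_mul_cancel₀ _ (by linarith)⟩
  have hc0 : 0 < c := by
    by_contra h
    have : 0 < 8 * D * Y := by positivity
    nlinarith
  set C1 : ℝ := 2 * D * a ^ 2 with hC1def
  have hC1 : 0 < C1 := by positivity
  -- choice of the threshold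
  have hM : ∃ n0 : ℕ, ∀ n, n0 ≤ n → c * r ^ (2 * n) ≤ 1 ∧ 4 * Y * r ^ (2 * n) ≤ 1 ∧
      (2 * Y + C1) * r ^ (2 * n) ≤ 1 ∧ r * (D * ((2 * Y + C1) * r ^ (2 * n))) * r ^ 2 ≤ 1 - r ∧
      2 * a * r ^ (2 * n) ≤ 1 := by
    have ht : Tendsto (fun n : ℕ => r ^ (2 * n)) atTop (nhds 0) := by
      simp_rw [pow_mul]
      exact tendsto_pow_atTop_nhds_zero_of_lt_one (by positivity) hr2
    have hmul : ∀ (A B : ℝ), 0 < B → ∀ᶠ n : ℕ in atTop, A * r ^ (2 * n) ≤ B := by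
      intro A B hB
      have := ht.const_mul A
      rw [mul_zero] at this
      exact this.eventually_le_const hB
    have h := ((hmul c 1 one_pos).and ((hmul (4 * Y) 1 one_pos).and
      ((hmul (2 * Y + C1) 1 one_pos).and
      ((hmul (r * (D * (2 * Y + C1)) * r ^ 2) (1 - r) (by linarith)).and
      (hmul (2 * a) 1 one_pos)))))
    obtain ⟨n0, h0⟩ := eventually_atTop.1 h
    refine ⟨n0, fun n hn => ?_⟩
    obtain ⟨a1, a2, a3, a4, a5⟩ := h0 n hn
    refine ⟨a1, a2, a3, ?_, a5⟩
    linarith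
  obtain ⟨n0, hn0⟩ := hM
  have nz : Nice T (fun _ => (0 : ℝ)) := nice_const T 0
  have hupos : ∀ n, 0 < r ^ (2 * n) := fun n => by positivity
  have husucc : ∀ n, r ^ (2 * (n + 1)) = r ^ 2 * r ^ (2 * n) := fun n => by ring
  have husle : ∀ n, r ^ (2 * (n + 1)) ≤ r ^ (2 * n) := fun n =>
    pow_le_pow_of_le_one hr0.le hr1.le (by omega)
  have cosb : ∀ α : ℝ, 0 ≤ α → ∀ φ, |α * Real.cos (Real.sqrt β * φ)| ≤ α := by
    intro α hα φ
    rw [abs_mul, abs_of_nonneg hα]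
    have := Real.abs_cos_le_one (Real.sqrt β * φ)
    nlinarith
  -- size bounds
  have size : ∀ j n : ℕ, n0 ≤ n →
      Abd (gm L) ρ (SGv L β a (n + j) n) (Y * (1 + c * r ^ (2 * n)) * r ^ (2 * n)) := by
    intro j
    induction j with
    | zero =>
      intro n hn
      have hu := hupos n
      have hb := hK (SGv L β a n n) (hnice _ _) 0 (a * r ^ (2 * n)) (fun φ => by
        rw [sub_zero, hself n]; exact cosb _ (by positivity) φ)
      refine Abd.mono hρ0.le ?_ hb
      have : 0 ≤ Y * (c * r ^ (2 * n)) * r ^ (2 * n) := by positivity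
      rw [hYdef] at *
      linarith
    | succ j ih =>
      intro n hn
      obtain ⟨b1, b2, -⟩ := hn0 n hn
      have hu := hupos n
      have h1 := ih (n + 1) (by omega)
      rw [husucc] at h1
      have hst := size_step hD hY hr0 hr1 hc hc0 hu b1 hP
      set x := Y * (1 + c * (r ^ 2 * r ^ (2 * n))) * (r ^ 2 * r ^ (2 * n)) with hxdef
      have hx : x ≤ Y * (1 + 1) * r ^ (2 * n) := by
        have h0 : r ^ 2 * r ^ (2 * n) ≤ r ^ (2 * n) := by rw [← husucc]; exact husle n
        have : c * (r ^ 2 * r ^ (2 * n)) ≤ 1 := (mul_le_mul_of_nonneg_left h0 hc0.le).trans b1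
        rw [hxdef]
        gcongr
      have hs := step hK (hnice (n + 1 + j) (n + 1)) nz h1 (d := x) (by simpa using h1)
        (by linarith)
      simp only [R_zero, sub_zero] at hs
      rw [SGv_succ L β a (n + (j + 1)) n (by omega), show n + (j + 1) = n + 1 + j by ring]
      refine Abd.mono hρ0.le (le_trans (le_of_eq ?_) hst) hs
      rw [hDdef]
      ring
  have size2 : ∀ j n : ℕ, n0 ≤ n → Abd (gm L) ρ (SGv L β a (n + j) n) (2 * Y * r ^ (2 * n)) := by
    intro j n hn
    refine Abd.mono hρ0.le ?_ (size j n hn)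
    obtain ⟨b1, -⟩ := hn0 n hn
    have hu := hupos n
    have : Y * (c * r ^ (2 * n)) * r ^ (2 * n) ≤ Y * 1 * r ^ (2 * n) := by gcongr
    linarith
  -- difference bounds
  have diff : ∀ j n : ℕ, n0 ≤ n →
      Abd (gm L) ρ (fun φ => SGv L β a (n + j + 1) n φ - SGv L β a (n + j) n φ)
        (C1 * r ^ ((n + j) + 3 * n)) := by
    intro j
    induction j with
    | zero =>
      intro n hn
      obtain ⟨-, -, -, -, b5⟩ := hn0 n hn
      have hu := hupos n
      have hu1 := hupos (n + 1)
      set α := a * r ^ (2 * (n + 1)) with hα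
      have hα0 : 0 ≤ α := by positivity
      have hαle : α ≤ a * r ^ (2 * n) := by rw [hα]; gcongr ?_ * ?_; exact husle n
      have hq := R_lin L (hnice (n + 1) (n + 1)) nz (m1 := 0) (md := 0) (x := α) (d := α)
        (fun φ => by rw [sub_zero, hself]; exact cosb _ hα0 φ)
        (fun φ => by rw [sub_zero, sub_zero, hself]; exact cosb _ hα0 φ) (by linarith)
      simp only [R_zero, sub_zero] at hq
      have e : ∀ φ, (L : ℝ) ^ 2 * PP (gm L) (fun φ => SGv L β a (n + 1) (n + 1) φ) φ =
          SGv L β a n n φ := by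
        intro φ
        simp only [hself]
        rw [PP_smul]
        simp only [hcos, husucc]
        linear_combination (a * r ^ (2 * n) * Real.cos (Real.sqrt β * φ)) * hP
      simp only [e] at hq
      have := hK _ ((hnice (n + 1) n).sub (hnice n n)) 0 _ (fun φ => by
        rw [sub_zero, SGv_succ L β a (n + 1) n (by omega)]; exact hq φ)
      refine Abd.mono hρ0.le ?_ this
      calc K * ((L : ℝ) ^ 2 * (17 * (α + α) * α)) = 2 * D * (α * α) := by rw [hDdef]; ring
        _ ≤ 2 * D * ((a * r ^ (2 * n)) * (a * r ^ (2 * n))) := by gcongr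
        _ = _ := by rw [hC1def]; ring
    | succ j ih =>
      intro n hn
      obtain ⟨b1, b2, b3, b4, b5⟩ := hn0 n hn
      have hu := hupos n
      have h1 := ih (n + 1) (by omega)
      have hx1 := size2 (j + 1) (n + 1) (by omega)
      have hx := Abd.mono hρ0.le (y := 2 * Y * r ^ (2 * n)) (by gcongr ?_ * ?_; exact husle n) hx1
      set d := C1 * r ^ (n + 1 + j + 3 * (n + 1)) with hd
      have hd0 : 0 < d := by positivity
      have hdle : d ≤ C1 * r ^ (2 * n) := by
        rw [hd]; gcongr ?_ * ?_
        exact pow_le_pow_of_le_one hr0.le hr1.le (by omega)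
      set x := 2 * Y * r ^ (2 * n) with hxd
      have hsum : x + d ≤ (2 * Y + C1) * r ^ (2 * n) := by rw [hxd]; linarith
      have hs := step hK (hnice (n + 1 + j + 1) (n + 1)) (hnice (n + 1 + j) (n + 1)) hx h1
        (by linarith)
      rw [SGv_succ L β a (n + (j + 1) + 1) n (by omega), SGv_succ L β a (n + (j + 1)) n (by omega),
        show n + (j + 1) = n + 1 + j by ring]
      refine Abd.mono hρ0.le ?_ hs
      have f1 : (L : ℝ) ^ 2 * ρ * d + K * ((L : ℝ) ^ 2 * (17 * (x + d) * d)) =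
        ((L : ℝ) ^ 2 * ρ + D * (x + d)) * d := by rw [hDdef]; ring
      have f2 : ((L : ℝ) ^ 2 * ρ + D * (x + d)) * r ^ 3 ≤ 1 := by
        have g1 : r * (D * (x + d)) * r ^ 2 ≤ r * (D * ((2 * Y + C1) * r ^ (2 * n))) * r ^ 2 := by
          gcongr
        have g2 : (L : ℝ) ^ 2 * ρ * r ^ 3 = r := by linear_combination r * hP
        have g3 : ((L : ℝ) ^ 2 * ρ + D * (x + d)) * r ^ 3 =
          (L : ℝ) ^ 2 * ρ * r ^ 3 + r * (D * (x + d)) * r ^ 2 := by ring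
        linarith
      rw [f1]
      have f3 : d = r ^ 3 * (C1 * r ^ (n + 1 + j + 3 * n)) := by rw [hd]; ring
      rw [f3, ← mul_assoc]
      rw [f3] at f2
      exact mul_le_of_le_one_left (by positivity) f2
  refine ⟨n0, C1, hC1, fun N n hn hN => ?_⟩
  obtain ⟨j, rfl⟩ := Nat.exists_eq_add_of_le hN
  obtain ⟨m, hm⟩ := diff j n hn
  refine ⟨m, fun φ => ?_⟩
  have := hm 0 φ
  simp only [Function.iterate_zero, id, pow_zero, one_mul] at this
  refine this.trans ?_
  gcongr ?_ * ?_
  exact pow_le_pow_of_le_one hr0.le hr1.le (by omega)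

end SG

theorem stmt2 (L : ℕ) (hL : 2 ≤ L) (β a : ℝ) (hβ0 : 0 < β) (hβ2 : β < 2) (ha : 0 < a) :
    ∃ C : ℝ, 0 < C ∧ ∀ N n : ℕ, 1 ≤ n → n ≤ N →
      ∃ c : ℝ, ∀ φ : ℝ,
        |SGv L β a (N + 1) n φ - SGv L β a N n φ - c| ≤
          C * (L : ℝ) ^ (-(1 / 2 : ℝ) * (2 - β) * (N : ℝ)) := by
  obtain ⟨n0, C1, hC1, hmain⟩ := SG.main_large L hL hβ0 hβ2 ha
  have hL1 : (1 : ℝ) < L := by exact_mod_cast (by omega : 1 < L)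
  have hL0 : (0 : ℝ) < L := by linarith
  have hr0 : 0 < (L : ℝ) ^ (-(2 - β) / 2) := Real.rpow_pos_of_pos hL0 _
  have hr1 : (L : ℝ) ^ (-(2 - β) / 2) < 1 := Real.rpow_lt_one_of_one_lt_of_neg hL1 (by linarith)
  have hself := SG.SGv_self L hL β a
  have hrp : ∀ N : ℕ, (L : ℝ) ^ (-(1 / 2 : ℝ) * (2 - β) * (N : ℝ)) =
      ((L : ℝ) ^ (-(2 - β) / 2)) ^ N := by
    intro N
    rw [← Real.rpow_natCast, ← Real.rpow_mul hL0.le]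
    congr 1
    ring
  simp only [hrp]
  generalize (L : ℝ) ^ (-(2 - β) / 2) = r at *
  set B : ℝ := ((L : ℝ) ^ 2 * a + a) with hB
  have hB0 : 0 < B := by positivity
  have hinit : ∀ N φ, |SGv L β a N N φ| ≤ a := by
    intro N φ
    rw [hself, abs_mul, abs_of_nonneg (by positivity)]
    have h1 := Real.abs_cos_le_one (Real.sqrt β * φ)
    have h2 : r ^ (2 * N) ≤ 1 := pow_le_one₀ hr0.le hr1.le
    calc _ ≤ a * 1 * 1 := by gcongr
      _ = a := by ring
  refine ⟨((L : ℝ) ^ 2) ^ n0 * (C1 + B / r ^ n0), by positivity, fun N n _ hnN => ?_⟩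
  have key : ∃ i, i ≤ n0 ∧ n + i ≤ N ∧
      ∃ c, ∀ φ, |SGv L β a (N + 1) (n + i) φ - SGv L β a N (n + i) φ - c| ≤
        (C1 + B / r ^ n0) * r ^ N := by
    have hpos : 0 ≤ B / r ^ n0 * r ^ N := by positivity
    by_cases hN : n0 ≤ N
    · refine ⟨n0 - n, by omega, by omega, ?_⟩
      obtain ⟨c, hc⟩ := hmain N (n + (n0 - n)) (by omega) (by omega)
      exact ⟨c, fun φ => (hc φ).trans (by linarith)⟩
    · refine ⟨N - n, by omega, by omega, 0, fun φ => ?_⟩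
      rw [show n + (N - n) = N by omega, sub_zero, SG.SGv_succ L β a (N + 1) N (by omega)]
      have h1 := SG.R_bdd L (SG.SGv_nice L hβ0 a (N + 1) (N + 1)).1 (hinit (N + 1)) φ
      have h2 := hinit N φ
      have h3 := abs_sub (SGRG L (SGv L β a (N + 1) (N + 1)) φ) (SGv L β a N N φ)
      have h4 : B ≤ B / r ^ n0 * r ^ N := by
        rw [div_mul_eq_mul_div, le_div_iff₀ (by positivity)]
        gcongr ?_ * ?_
        exact pow_le_pow_of_le_one hr0.le hr1.le (by omega)
      have h5 : 0 ≤ C1 * r ^ N := by positivity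
      linarith
  obtain ⟨i, hi, hiN, hc⟩ := key
  obtain ⟨c, hc⟩ := SG.descent L hβ0 a _ N i n hiN hc
  refine ⟨c, fun φ => (hc φ).trans ?_⟩
  rw [mul_assoc]
  gcongr ?_ * ?_
  exact pow_le_pow_right₀ (by nlinarith) hi
end

section
/- For σ ∈ ℝ and m ∈ ℕ define the variance-σ Wick power (Hermite polynomial) :x^m:_σ := Σ_{j=0}^{⌊m/2⌋} (m!/(j!·(m−2j)!))·(−σ/2)^j·x^{m−2j}. Then for all m ∈ ℕ, all reals a, σ, y, and all τ > 0, if ζ is a centered Gaussian random variable of variance τ, then E[:(a·y + ζ)^m:_{a²σ+τ}] = a^m·:y^m:_σ. In particular, with τ := 1 − L^{−3}, a := L^{−1/2} and G := (1−L^{−1})^{−1}·(1−L^{−3}) (which satisfies G = L^{−1}·G + τ), one has L³·E[:(L^{−1/2}y + ζ)^m:_G] = L^{3−m/2}·:y^m:_G for every y ∈ ℝ. -/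
open MeasureTheory ProbabilityTheory Filter

/-- The variance-`σ` Wick power (Hermite polynomial)
`:x^m:_σ = Σ_{j=0}^{⌊m/2⌋} (m!/(j!(m-2j)!))·(-σ/2)^j·x^{m-2j}`. -/
noncomputable def wick (σ : ℝ) (m : ℕ) (x : ℝ) : ℝ :=
  ∑ j ∈ Finset.range (m / 2 + 1),
    ((m.factorial : ℝ) / ((j.factorial : ℝ) * ((m - 2 * j).factorial : ℝ)))
      * (-σ / 2) ^ j * x ^ (m - 2 * j)

/-- The general Wick term, zero beyond the range. -/
noncomputable def wickT (σ : ℝ) (m : ℕ) (x : ℝ) (j : ℕ) : ℝ :=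
  if 2 * j ≤ m then ((m.factorial : ℝ) / ((j.factorial : ℝ) * ((m - 2 * j).factorial : ℝ)))
      * (-σ / 2) ^ j * x ^ (m - 2 * j) else 0

lemma wick_eq_wickT (σ : ℝ) (m : ℕ) (x : ℝ) (N : ℕ) (hN : m < N) :
    wick σ m x = ∑ j ∈ Finset.range N, wickT σ m x j := by
  unfold wick
  rw [← Finset.sum_subset (Finset.range_mono (show m / 2 + 1 ≤ N by omega))]
  · refine Finset.sum_congr rfl fun j hj => ?_
    rw [Finset.mem_range] at hj
    rw [wickT, if_pos (by omega)]
  · intro j _ hj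
    rw [Finset.mem_range] at hj
    rw [wickT, if_neg (by omega)]

lemma wickT_rec (σ : ℝ) (m : ℕ) (x : ℝ) (j : ℕ) :
    wickT σ (m + 2) x (j + 1) = x * wickT σ (m + 1) x (j + 1) - σ * (m + 1) * wickT σ m x j := by
  rcases lt_trichotomy m (2 * j) with h | h | h
  · simp only [wickT]
    rw [if_neg (by omega), if_neg (by omega), if_neg (by omega)]; ring
  · subst h
    simp only [wickT]
    rw [if_pos (by omega), if_neg (by omega), if_pos (by omega)]
    have e1 : 2 * j + 2 - 2 * (j + 1) = 0 := by omega
    rw [e1, Nat.sub_self]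
    simp only [Nat.factorial_succ]
    push_cast
    have := Nat.factorial_pos j
    field_simp
    ring
  · obtain ⟨k, rfl⟩ : ∃ k, m = 2 * j + 1 + k := ⟨m - (2 * j + 1), by omega⟩
    simp only [wickT]
    rw [if_pos (by omega), if_pos (by omega), if_pos (by omega)]
    have e1 : 2 * j + 1 + k + 2 - 2 * (j + 1) = k + 1 := by omega
    have e2 : 2 * j + 1 + k + 1 - 2 * (j + 1) = k := by omega
    have e3 : 2 * j + 1 + k - 2 * j = k + 1 := by omega
    rw [e1, e2, e3]
    simp only [Nat.factorial_succ]
    push_cast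
    have := Nat.factorial_pos j
    have := Nat.factorial_pos k
    field_simp
    ring

lemma wick_rec (σ : ℝ) (m : ℕ) (x : ℝ) :
    wick σ (m + 2) x = x * wick σ (m + 1) x - σ * (m + 1) * wick σ m x := by
  rw [wick_eq_wickT σ (m + 2) x (m + 2 + 1) (by omega),
    wick_eq_wickT σ (m + 1) x (m + 2 + 1) (by omega), wick_eq_wickT σ m x (m + 2) (by omega),
    Finset.sum_range_succ', Finset.sum_range_succ' _ (m + 2)]
  simp only [wickT_rec, Finset.sum_sub_distrib, Finset.mul_sum, mul_add]
  have : wickT σ (m + 2) x 0 = x * wickT σ (m + 1) x 0 := by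
    have h1 := Nat.factorial_pos (m + 1)
    have h2 := Nat.factorial_pos (m + 2)
    simp only [wickT]
    simp
    field_simp
    ring
  rw [this]; ring

lemma wick_zero (σ x : ℝ) : wick σ 0 x = 1 := by simp [wick]

lemma wick_one (σ x : ℝ) : wick σ 1 x = x := by simp [wick]

lemma wick_hasDerivAt (σ : ℝ) (m : ℕ) (x : ℝ) :
    HasDerivAt (wick σ (m + 1)) ((m + 1) * wick σ m x) x := by
  induction m using Nat.strong_induction_on with
  | _ m ih =>
    rcases m with _ | _ | m
    · have : wick σ (0 + 1) = fun x => x := funext fun x => wick_one σ x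
      rw [this, wick_zero]
      exact (hasDerivAt_id' x).congr_deriv (by simp)
    · have : wick σ (0 + 1 + 1) = fun x => x * x - σ := by
        funext x
        rw [show 0 + 1 + 1 = 0 + 2 from rfl, wick_rec, wick_zero, wick_one]; simp
      rw [this, wick_one]
      exact (((hasDerivAt_id' x).fun_mul (hasDerivAt_id' x)).sub_const σ).congr_deriv
        (by push_cast; ring)
    · have : wick σ (m + 1 + 1 + 1)
          = fun x => x * wick σ (m + 1 + 1) x - σ * ((m + 1 : ℕ) + 1) * wick σ (m + 1) x := by
        funext x
        exact wick_rec σ (m + 1) x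
      rw [this]
      have h1 := ih (m + 1) (by omega)
      have h0 := ih m (by omega)
      refine (((hasDerivAt_id' x).fun_mul h1).fun_sub
        (h0.const_mul (σ * ((m + 1 : ℕ) + 1)))).congr_deriv ?_
      have := wick_rec σ m x
      push_cast
      rw [show m + 1 + 1 = m + 2 from rfl, this]
      ring

lemma integrable_pow_gauss (v : NNReal) (n : ℕ) :
    Integrable (fun x : ℝ => x ^ n) (gaussianReal 0 v) := by
  have := (memLp_id_gaussianReal (μ := 0) (v := v) (n : NNReal)).integrable_norm_pow'
  refine (integrable_norm_iff (by fun_prop)).1 ?_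
  simpa [norm_pow] using this

lemma integrable_poly_gauss (v : NNReal) (p : Polynomial ℝ) :
    Integrable (fun x : ℝ => p.eval x) (gaussianReal 0 v) := by
  simp only [Polynomial.eval_eq_sum_range]
  exact integrable_finsetSum _ fun i _ => (integrable_pow_gauss v i).const_mul _

lemma stein_gauss (v : NNReal) (hv : v ≠ 0) (p : Polynomial ℝ) :
    ∫ x, x * p.eval x ∂(gaussianReal 0 v) = v * ∫ x, p.derivative.eval x ∂(gaussianReal 0 v) := by
  have key : ∀ q : Polynomial ℝ, Integrable (fun x => gaussianPDFReal 0 v x * q.eval x) := by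
    intro q
    have := integrable_poly_gauss v q
    rw [gaussianReal_of_var_ne_zero _ hv, integrable_withDensity_iff_integrable_smul'
      (measurable_gaussianPDF 0 v) (ae_of_all _ fun x => gaussianPDF_lt_top)] at this
    simpa [toReal_gaussianPDF] using this
  rw [integral_gaussianReal_eq_integral_smul hv, integral_gaussianReal_eq_integral_smul hv,
    ← integral_const_mul]
  simp only [smul_eq_mul]
  have hd : ∀ x, HasDerivAt (fun x => v * (gaussianPDFReal 0 v x * p.eval x))
      (v * (gaussianPDFReal 0 v x * p.derivative.eval x)
        - gaussianPDFReal 0 v x * (x * p.eval x)) x := by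
    intro x
    have hg : HasDerivAt (gaussianPDFReal 0 v) (gaussianPDFReal 0 v x * (-x / v)) x := by
      have h1 : HasDerivAt (fun x : ℝ => -(x - 0) ^ 2 / (2 * (v : ℝ))) (-x / v) x := by
        refine (((((hasDerivAt_id' x).sub_const 0).fun_pow 2).fun_neg).div_const
          (2 * (v : ℝ))).congr_deriv ?_
        have : (v : ℝ) ≠ 0 := by exact_mod_cast hv
        field_simp
        simp
        ring
      have h2 := (h1.exp).const_mul (√(2 * Real.pi * v))⁻¹
      rw [gaussianPDFReal_def]
      exact h2.congr_deriv (by ring)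
    refine ((hg.fun_mul (p.hasDerivAt x)).const_mul (v : ℝ)).congr_deriv ?_
    have : (v : ℝ) ≠ 0 := by exact_mod_cast hv
    field_simp
    ring
  have i1 := (key p.derivative).const_mul (v : ℝ)
  have i2 : Integrable (fun x => gaussianPDFReal 0 v x * (x * p.eval x)) := by
    have := key (Polynomial.X * p)
    simp only [Polynomial.eval_mul, Polynomial.eval_X] at this
    exact this
  have := integral_eq_zero_of_hasDerivAt_of_integrable hd (i1.sub i2) ((key p).const_mul _)
  rw [integral_sub i1 i2] at this
  linarith

lemma wick_poly (σ : ℝ) (m : ℕ) (b : ℝ) :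
    ∃ p : Polynomial ℝ, ∀ x, p.eval x = wick σ m (b + x) := by
  refine ⟨∑ j ∈ Finset.range (m / 2 + 1),
    Polynomial.C (((m.factorial : ℝ) / ((j.factorial : ℝ) * ((m - 2 * j).factorial : ℝ)))
      * (-σ / 2) ^ j) * (Polynomial.C b + Polynomial.X) ^ (m - 2 * j), fun x => ?_⟩
  simp [wick, Polynomial.eval_finsetSum]

lemma wick_gauss (v : NNReal) (hv : v ≠ 0) (a σ y : ℝ) (m : ℕ) :
    ∫ ζ, wick (a ^ 2 * σ + v) m (a * y + ζ) ∂(gaussianReal 0 v) = a ^ m * wick σ m y := by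
  induction m using Nat.strong_induction_on with
  | _ m ih =>
    have hint : ∀ n, Integrable (fun ζ => wick (a ^ 2 * σ + v) n (a * y + ζ))
        (gaussianReal 0 v) := by
      intro n
      obtain ⟨p, hp⟩ := wick_poly (a ^ 2 * σ + v) n (a * y)
      simpa only [hp] using integrable_poly_gauss v p
    rcases m with _ | _ | m
    · simp [wick_zero]
    · simp only [zero_add, wick_one]
      rw [integral_add (by fun_prop) (by simpa using integrable_pow_gauss v 1),
        integral_id_gaussianReal]
      simp
    · have h1 := ih (m + 1) (by omega)
      have h0 := ih m (by omega)
      obtain ⟨p, hp⟩ := wick_poly (a ^ 2 * σ + v) (m + 1) (a * y)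
      have hder : ∀ x, p.derivative.eval x = (m + 1) * wick (a ^ 2 * σ + v) m (a * y + x) := by
        intro x
        have e1 := p.hasDerivAt x
        have e2 := (wick_hasDerivAt (a ^ 2 * σ + v) m (a * y + x)).comp_const_add (a * y) x
        rw [show (fun x => p.eval x) = _ from funext hp] at e1
        exact e1.unique e2
      have st := stein_gauss v hv p
      have ix : Integrable (fun x => x * p.eval x) (gaussianReal 0 v) := by
        have := integrable_poly_gauss v (Polynomial.X * p)
        simp only [Polynomial.eval_mul, Polynomial.eval_X] at this
        exact this
      simp only [hder, hp, integral_const_mul] at st ix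
      simp only [show m + 1 + 1 = m + 2 from rfl, wick_rec, add_mul (a * y)]
      rw [integral_sub (((hint _).const_mul _).fun_add ix) ((hint _).const_mul _),
        integral_add ((hint _).const_mul _) ix, integral_const_mul, integral_const_mul, st, h1, h0]
      ring

theorem stmt11 (L : ℕ) (hL : 2 ≤ L) :
    -- general covariance-shift identity for Wick powers
    (∀ (m : ℕ) (a σ y τ : ℝ), 0 < τ →
      ∫ ζ, wick (a ^ 2 * σ + τ) m (a * y + ζ) ∂(gaussianReal 0 τ.toNNReal)
        = a ^ m * wick σ m y) ∧
    -- G = L⁻¹·G + τ for G = (1-L⁻¹)⁻¹(1-L⁻³), τ = 1-L⁻³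
    ((1 - (L : ℝ)⁻¹)⁻¹ * (1 - ((L : ℝ) ^ 3)⁻¹)
      = (L : ℝ)⁻¹ * ((1 - (L : ℝ)⁻¹)⁻¹ * (1 - ((L : ℝ) ^ 3)⁻¹)) + (1 - ((L : ℝ) ^ 3)⁻¹)) ∧
    -- Wick powers are eigenfunctions of the linearized 3d hierarchical RG map
    (∀ (m : ℕ) (y : ℝ),
      (L : ℝ) ^ 3 *
          ∫ ζ, wick ((1 - (L : ℝ)⁻¹)⁻¹ * (1 - ((L : ℝ) ^ 3)⁻¹)) m
              ((L : ℝ) ^ (-(1 : ℝ) / 2) * y + ζ)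
            ∂(gaussianReal 0 (1 - ((L : ℝ) ^ 3)⁻¹).toNNReal)
        = (L : ℝ) ^ ((3 : ℝ) - (m : ℝ) / 2) *
            wick ((1 - (L : ℝ)⁻¹)⁻¹ * (1 - ((L : ℝ) ^ 3)⁻¹)) m y) := by
  have hL0 : (0 : ℝ) < L := by exact_mod_cast (by omega : 0 < L)
  have hL1 : (1 : ℝ) < L := by exact_mod_cast (by omega : 1 < L)
  have hgen : ∀ (m : ℕ) (a σ y τ : ℝ), 0 < τ →
      ∫ ζ, wick (a ^ 2 * σ + τ) m (a * y + ζ) ∂(gaussianReal 0 τ.toNNReal)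
        = a ^ m * wick σ m y := by
    intro m a σ y τ hτ
    have := wick_gauss τ.toNNReal (by simpa using hτ) a σ y m
    rwa [Real.coe_toNNReal _ hτ.le] at this
  have hG : ((1 - (L : ℝ)⁻¹)⁻¹ * (1 - ((L : ℝ) ^ 3)⁻¹)
      = (L : ℝ)⁻¹ * ((1 - (L : ℝ)⁻¹)⁻¹ * (1 - ((L : ℝ) ^ 3)⁻¹)) + (1 - ((L : ℝ) ^ 3)⁻¹)) := by
    have h : 1 - (L : ℝ)⁻¹ ≠ 0 := (sub_pos.2 (inv_lt_one_of_one_lt₀ hL1)).ne'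
    generalize (1 - ((L : ℝ) ^ 3)⁻¹) = t
    have := mul_inv_cancel₀ h
    linear_combination t * this
  refine ⟨hgen, hG, fun m y => ?_⟩
  have hτ : 0 < 1 - ((L : ℝ) ^ 3)⁻¹ :=
    sub_pos.2 (inv_lt_one_of_one_lt₀ (one_lt_pow₀ hL1 (by norm_num)))
  have h := hgen m ((L : ℝ) ^ (-(1 : ℝ) / 2)) ((1 - (L : ℝ)⁻¹)⁻¹ * (1 - ((L : ℝ) ^ 3)⁻¹)) y _ hτ
  have ha : ((L : ℝ) ^ (-(1 : ℝ) / 2)) ^ 2 = (L : ℝ)⁻¹ := by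
    rw [← Real.rpow_mul_natCast hL0.le, ← Real.rpow_neg_one]
    norm_num
  rw [ha, ← hG] at h
  rw [h, ← mul_assoc]
  congr 1
  rw [← Real.rpow_mul_natCast hL0.le, ← Real.rpow_natCast (L : ℝ) 3, ← Real.rpow_add hL0]
  congr 1
  push_cast
  ring
end
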